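/- The stochastic-limit generator L applied to the cash operator k̂ gives L(k̂) = −P̂·( 2·Re(Γ_Z^b)·z z† − 2·Re(Γ_Z^a)·z†z ); in particular the identity L(k̂) + P̂·L(n̂) = 0 holds as linear operators on V. -/

import Mathlib

/- Context: V is the free complex vector space on the basis
{φ_{n,k,m} : n, k, m ∈ ℕ} (share number n, cash k, price m). -/

noncomputable section

abbrev V3 := (ℕ × ℕ × ℕ) →₀ ℂ

/-- a : φ_{n,k,m} ↦ √n φ_{n−1,k,m}. -/
def aOp : Module.End ℂ V3 :=
  Finsupp.lift _ ℂ (ℕ × ℕ × ℕ) fun i =>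
    Finsupp.single (i.1 - 1, i.2.1, i.2.2) ((Real.sqrt i.1 : ℝ) : ℂ)

/-- a† : φ_{n,k,m} ↦ √(n+1) φ_{n+1,k,m}. -/
def adag : Module.End ℂ V3 :=
  Finsupp.lift _ ℂ (ℕ × ℕ × ℕ) fun i =>
    Finsupp.single (i.1 + 1, i.2.1, i.2.2) ((Real.sqrt (i.1 + 1) : ℝ) : ℂ)

/-- c : φ_{n,k,m} ↦ √k φ_{n,k−1,m}. -/
def cOp : Module.End ℂ V3 :=
  Finsupp.lift _ ℂ (ℕ × ℕ × ℕ) fun i =>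
    Finsupp.single (i.1, i.2.1 - 1, i.2.2) ((Real.sqrt i.2.1 : ℝ) : ℂ)

/-- c† : φ_{n,k,m} ↦ √(k+1) φ_{n,k+1,m}. -/
def cdag : Module.End ℂ V3 :=
  Finsupp.lift _ ℂ (ℕ × ℕ × ℕ) fun i =>
    Finsupp.single (i.1, i.2.1 + 1, i.2.2) ((Real.sqrt (i.2.1 + 1) : ℝ) : ℂ)

/-- p : φ_{n,k,m} ↦ √m φ_{n,k,m−1}. -/
def pOp : Module.End ℂ V3 :=
  Finsupp.lift _ ℂ (ℕ × ℕ × ℕ) fun i =>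
    Finsupp.single (i.1, i.2.1, i.2.2 - 1) ((Real.sqrt i.2.2 : ℝ) : ℂ)

/-- p† : φ_{n,k,m} ↦ √(m+1) φ_{n,k,m+1}. -/
def pdag : Module.End ℂ V3 :=
  Finsupp.lift _ ℂ (ℕ × ℕ × ℕ) fun i =>
    Finsupp.single (i.1, i.2.1, i.2.2 + 1) ((Real.sqrt (i.2.2 + 1) : ℝ) : ℂ)

/-- n̂ = a†a. -/
def nhat : Module.End ℂ V3 := adag * aOp
/-- k̂ = c†c. -/
def khat : Module.End ℂ V3 := cdag * cOp
/-- P̂ = p†p. -/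
def Phat : Module.End ℂ V3 := pdag * pOp

/-- c^P̂ : φ_{n,k,m} ↦ φ_{n,k,m} if m = 0; 0 if m > k;
√(k(k−1)⋯(k−m+1)) φ_{n,k−m,m} if 0 < m ≤ k. -/
def cPowP : Module.End ℂ V3 :=
  Finsupp.lift _ ℂ (ℕ × ℕ × ℕ) fun i =>
    if i.2.2 ≤ i.2.1 then
      Finsupp.single (i.1, i.2.1 - i.2.2, i.2.2)
        ((Real.sqrt (∏ j ∈ Finset.range i.2.2, ((i.2.1 : ℝ) - j)) : ℝ) : ℂ)
    else 0

/-- (c†)^P̂ : φ_{n,k,m} ↦ φ_{n,k,m} if m = 0;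
√((k+1)⋯(k+m)) φ_{n,k+m,m} if m > 0. -/
def cdagPowP : Module.End ℂ V3 :=
  Finsupp.lift _ ℂ (ℕ × ℕ × ℕ) fun i =>
    Finsupp.single (i.1, i.2.1 + i.2.2, i.2.2)
      ((Real.sqrt (∏ j ∈ Finset.range i.2.2, ((i.2.1 : ℝ) + j + 1)) : ℝ) : ℂ)

/-- z = a·(c†)^P̂. -/
def zOp : Module.End ℂ V3 := aOp * cdagPowP
/-- z† = a†·c^P̂. -/
def zdag : Module.End ℂ V3 := adag * cPowP

/-- The commutator [A,B] = AB − BA. -/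
def opComm (A B : Module.End ℂ V3) : Module.End ℂ V3 := A * B - B * A

/-- The stochastic-limit generator
L(X) = Γ_Z^a[z†,X]z − conj(Γ_Z^a)z†[z,X] + Γ_Z^b[z,X]z† − conj(Γ_Z^b)z[z†,X]
     + Γ_O^a[p†,X]p − conj(Γ_O^a)p†[p,X] + Γ_O^b[p,X]p† − conj(Γ_O^b)p[p†,X]. -/
def gen (ΓZa ΓZb ΓOa ΓOb : ℂ) (X : Module.End ℂ V3) : Module.End ℂ V3 :=
  ΓZa • (opComm zdag X * zOp) - (starRingEnd ℂ) ΓZa • (zdag * opComm zOp X)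
    + ΓZb • (opComm zOp X * zdag) - (starRingEnd ℂ) ΓZb • (zOp * opComm zdag X)
    + ΓOa • (opComm pdag X * pOp) - (starRingEnd ℂ) ΓOa • (pdag * opComm pOp X)
    + ΓOb • (opComm pOp X * pdag) - (starRingEnd ℂ) ΓOb • (pOp * opComm pdag X)

theorem ofReal_sqrt_succ_mul_self (n : ℕ) :
    ((Real.sqrt (n + 1) : ℝ) : ℂ) * ((Real.sqrt (n + 1) : ℝ) : ℂ) = n + 1 := by
  rw [← Complex.ofReal_mul, Real.mul_self_sqrt n.cast_add_one_pos.le]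
  push_cast
  rfl

theorem nhat_single (n k m : ℕ) (c : ℂ) :
    nhat (Finsupp.single (n, k, m) c) = (n : ℂ) • Finsupp.single (n, k, m) c := by
  rcases n with _ | n
  · simp [nhat, adag, aOp]
  · simp [nhat, adag, aOp, -Finsupp.single_mul, mul_assoc,
      ofReal_sqrt_succ_mul_self, mul_comm c (_ + 1)]

theorem khat_single (n k m : ℕ) (c : ℂ) :
    khat (Finsupp.single (n, k, m) c) = (k : ℂ) • Finsupp.single (n, k, m) c := by
  rcases k with _ | k
  · simp [khat, cdag, cOp]
  · simp [khat, cdag, cOp, -Finsupp.single_mul, mul_assoc,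
      ofReal_sqrt_succ_mul_self, mul_comm c (_ + 1)]

theorem Phat_single (n k m : ℕ) (c : ℂ) :
    Phat (Finsupp.single (n, k, m) c) = (m : ℂ) • Finsupp.single (n, k, m) c := by
  rcases m with _ | m
  · simp [Phat, pdag, pOp]
  · simp [Phat, pdag, pOp, -Finsupp.single_mul, mul_assoc,
      ofReal_sqrt_succ_mul_self, mul_comm c (_ + 1)]

/-- Operators on `V3` that agree on the basis vectors are equal. -/
theorem end_ext {A B : Module.End ℂ V3}
    (h : ∀ n k m, A (Finsupp.single (n, k, m) 1) = B (Finsupp.single (n, k, m) 1)) : A = B :=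
  Finsupp.lhom_ext' fun ⟨n, k, m⟩ => LinearMap.ext_ring (h n k m)

theorem zOp_single (n k m : ℕ) :
    ∃ r : ℂ, zOp (Finsupp.single (n, k, m) 1) = Finsupp.single (n - 1, k + m, m) r ∧
      (n = 0 → r = 0) := by
  refine ⟨_, by simp [zOp, aOp, cdagPowP, -Finsupp.single_mul]; rfl, ?_⟩
  rintro rfl
  simp

theorem zdag_single (n k m : ℕ) :
    ∃ r : ℂ, zdag (Finsupp.single (n, k, m) 1) = Finsupp.single (n + 1, k - m, m) r ∧
      (k < m → r = 0) := by
  by_cases h : m ≤ k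
  · exact ⟨_, by simp [zdag, adag, cPowP, h, -Finsupp.single_mul]; rfl, fun h' => absurd h h'.not_ge⟩
  · exact ⟨0, by simp [zdag, cPowP, h], fun _ => rfl⟩

theorem opComm_zOp_nhat : opComm zOp nhat = zOp := by
  refine end_ext fun n k m => ?_
  obtain ⟨r, hr, h0⟩ := zOp_single n k m
  rcases n with _ | n
  · simp [opComm, nhat_single, hr, h0]
  · simp [opComm, nhat_single, hr, -Finsupp.smul_single, ← sub_smul]

theorem opComm_zdag_nhat : opComm zdag nhat = -zdag := by
  refine end_ext fun n k m => ?_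
  obtain ⟨r, hr, -⟩ := zdag_single n k m
  simp [opComm, nhat_single, hr, -Finsupp.smul_single, ← sub_smul]

theorem opComm_zOp_khat : opComm zOp khat = -(Phat * zOp) := by
  refine end_ext fun n k m => ?_
  obtain ⟨r, hr, -⟩ := zOp_single n k m
  simp [opComm, khat_single, Phat_single, hr, -Finsupp.smul_single, ← sub_smul]

theorem opComm_zdag_khat : opComm zdag khat = Phat * zdag := by
  refine end_ext fun n k m => ?_
  obtain ⟨r, hr, h0⟩ := zdag_single n k m
  rcases lt_or_ge k m with h | h
  · simp [opComm, khat_single, hr, h0 h, -Finsupp.smul_single]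
  · simp [opComm, khat_single, Phat_single, hr, -Finsupp.smul_single, ← sub_smul, h]

theorem zOp_mul_Phat : zOp * Phat = Phat * zOp := by
  refine end_ext fun n k m => ?_
  obtain ⟨r, hr, -⟩ := zOp_single n k m
  simp [Phat_single, hr, -Finsupp.smul_single]

theorem zdag_mul_Phat : zdag * Phat = Phat * zdag := by
  refine end_ext fun n k m => ?_
  obtain ⟨r, hr, -⟩ := zdag_single n k m
  simp [Phat_single, hr, -Finsupp.smul_single]

theorem opComm_pOp_nhat : opComm pOp nhat = 0 :=
  end_ext fun n k m => by
    simp [opComm, nhat_single, pOp, -Finsupp.smul_single]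

theorem opComm_pdag_nhat : opComm pdag nhat = 0 :=
  end_ext fun n k m => by
    simp [opComm, nhat_single, pdag, -Finsupp.smul_single]

theorem opComm_pOp_khat : opComm pOp khat = 0 :=
  end_ext fun n k m => by
    simp [opComm, khat_single, pOp, -Finsupp.smul_single]

theorem opComm_pdag_khat : opComm pdag khat = 0 :=
  end_ext fun n k m => by
    simp [opComm, khat_single, pdag, -Finsupp.smul_single]

theorem gen_nhat (ΓZa ΓZb ΓOa ΓOb : ℂ) :
    gen ΓZa ΓZb ΓOa ΓOb nhat
      = ((2 * ΓZb.re : ℝ) : ℂ) • (zOp * zdag) - ((2 * ΓZa.re : ℝ) : ℂ) • (zdag * zOp) := by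
  rw [← Complex.add_conj, ← Complex.add_conj]
  refine LinearMap.ext fun v => ?_
  simp only [gen, opComm_zOp_nhat, opComm_zdag_nhat, opComm_pOp_nhat, opComm_pdag_nhat,
    LinearMap.add_apply, LinearMap.sub_apply, LinearMap.smul_apply, Module.End.mul_apply,
    LinearMap.neg_apply, LinearMap.zero_apply, map_neg, map_zero]
  module

theorem gen_khat (ΓZa ΓZb ΓOa ΓOb : ℂ) :
    gen ΓZa ΓZb ΓOa ΓOb khat
      = -(Phat * (((2 * ΓZb.re : ℝ) : ℂ) • (zOp * zdag)
          - ((2 * ΓZa.re : ℝ) : ℂ) • (zdag * zOp))) := by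
  rw [← Complex.add_conj, ← Complex.add_conj]
  refine LinearMap.ext fun v => ?_
  have hz (w : V3) : zOp (Phat w) = Phat (zOp w) := LinearMap.congr_fun zOp_mul_Phat w
  have hzd (w : V3) : zdag (Phat w) = Phat (zdag w) := LinearMap.congr_fun zdag_mul_Phat w
  simp only [gen, opComm_zOp_khat, opComm_zdag_khat, opComm_pOp_khat, opComm_pdag_khat,
    LinearMap.add_apply, LinearMap.sub_apply, LinearMap.smul_apply, Module.End.mul_apply,
    LinearMap.neg_apply, LinearMap.zero_apply, map_neg, map_zero, map_sub, map_smul, hz, hzd]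
  module

/-- the stochastic-limit generator applied to the cash operator:
L(k̂) = −P̂·(2Re(Γ_Z^b)·z z† − 2Re(Γ_Z^a)·z†z); in particular
L(k̂) + P̂·L(n̂) = 0. -/
theorem generator_on_khat (ΓZa ΓZb ΓOa ΓOb : ℂ) :
    gen ΓZa ΓZb ΓOa ΓOb khat
      = -(Phat * (((2 * ΓZb.re : ℝ) : ℂ) • (zOp * zdag)
          - ((2 * ΓZa.re : ℝ) : ℂ) • (zdag * zOp))) ∧
    gen ΓZa ΓZb ΓOa ΓOb khat + Phat * gen ΓZa ΓZb ΓOa ΓOb nhat = 0 := by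
  refine ⟨gen_khat .., ?_⟩
  rw [gen_khat, gen_nhat]
  exact neg_add_cancel (G := Module.End ℂ V3) _

end
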